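/- If there are k routers and all packets of instance I have length 1 or 2, then, for any tie-breaking rule, Greedy(I) ≤ (2 − 1/2^{k−1})·Opt(I) + 3; in particular, Greedy is (2 − 1/2^{k−1})-competitive on instances with all packet lengths in {1,2}. -/

import Mathlib

/-!
# Packet forwarding on a line network

There are `k` active routers `1, …, k`; router `i` forwards packets to router `i+1`.
An instance is a finite collection of packets; packet `p` has a release time `rel p : ℕ`,
a start router `start p ∈ {1, …, k}` and a length `len p ≥ 1` with
`start p + len p − 1 ≤ k`; `p` must be forwarded by routers
`start p, start p + 1, …, start p + len p − 1` in this order.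
-/

/-- An instance of online packet forwarding on a line network with `k` active routers.
Packets are indexed by `Fin n`. -/
structure PInstance (k : ℕ) where
  n : ℕ
  rel : Fin n → ℕ
  start : Fin n → ℕ
  len : Fin n → ℕ

namespace PInstance

variable {k : ℕ}

/-- The instance is well-formed: start routers are at least `1`, lengths are at least `1`,
and every packet fits on the line: `start p + len p − 1 ≤ k`. -/
def Valid (I : PInstance k) : Prop :=
  ∀ p, 1 ≤ I.start p ∧ 1 ≤ I.len p ∧ I.start p + I.len p ≤ k + 1

/-- All packets of the instance have length `1` or `2`. -/
def Short (I : PInstance k) : Prop :=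
  ∀ p, I.len p = 1 ∨ I.len p = 2

/-- A schedule assigns to each packet `p` and each hop index `j < len p` (corresponding to
router `start p + j`) the time step at which that router forwards `p`.  Values at
hop indices `j ≥ len p` are irrelevant. -/
abbrev Sched (I : PInstance k) := Fin I.n → ℕ → ℕ

/-- `arr I S p j` is the time from which hop `j` of packet `p` is available:
packet `p` is available at its start router from time `rel p`, and a packet forwarded
at time `t` is available at the next router from time `t + 1`. -/
def arr (I : PInstance k) (S : Sched I) (p : Fin I.n) : ℕ → ℕ
  | 0 => I.rel p
  | j + 1 => S p j + 1

/-- Feasibility of a schedule: every hop is forwarded no earlier than the time from which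
it is available (this includes releases and the order of the hops), and each router
forwards at most one packet in each time step. -/
def Feasible (I : PInstance k) (S : Sched I) : Prop :=
  (∀ p j, j < I.len p → arr I S p j ≤ S p j) ∧
  (∀ p q jp jq, jp < I.len p → jq < I.len q →
    I.start p + jp = I.start q + jq → S p jp = S q jq → p = q)

/-- Completion time `C(p)`: one plus the time step in which the last router forwards `p`. -/
def comp (I : PInstance k) (S : Sched I) (p : Fin I.n) : ℕ :=
  S p (I.len p - 1) + 1

/-- Flow time of packet `p`: `C(p) − r(p)`. -/
def flowTime (I : PInstance k) (S : Sched I) (p : Fin I.n) : ℕ :=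
  comp I S p - I.rel p

/-- Cost of a schedule: the maximum flow time over all packets of the instance. -/
def cost (I : PInstance k) (S : Sched I) : ℕ :=
  Finset.univ.sup (flowTime I S)

/-- `Opt(I)`: the minimum cost over all feasible schedules. -/
noncomputable def opt (I : PInstance k) : ℕ :=
  sInf {c | ∃ S : Sched I, Feasible I S ∧ cost I S = c}

/-- Hop `j` of packet `p` is waiting (available but not yet forwarded) at time `t`. -/
def Waiting (I : PInstance k) (S : Sched I) (p : Fin I.n) (j t : ℕ) : Prop :=
  j < I.len p ∧ arr I S p j ≤ t ∧ t ≤ S p j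

/-- Remaining length `ℓ(p,t)`: the number of routers that still need to forward `p`
at time `t` (under schedule `S`). -/
noncomputable def remLen (I : PInstance k) (S : Sched I) (p : Fin I.n) (t : ℕ) : ℕ :=
  Set.ncard {j : ℕ | j < I.len p ∧ t ≤ S p j}

/-- Priority `π(p,t) = (t − r(p)) + ℓ(p,t)`. -/
noncomputable def prio (I : PInstance k) (S : Sched I) (p : Fin I.n) (t : ℕ) : ℕ :=
  (t - I.rel p) + remLen I S p t

/-- A schedule is zealous if, at every time step and every router at which some packet
is available (waiting), it forwards a packet there. -/
def Zealous (I : PInstance k) (S : Sched I) : Prop :=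
  ∀ t i, (∃ p j, Waiting I S p j t ∧ I.start p + j = i) →
    ∃ q jq, Waiting I S q jq t ∧ I.start q + jq = i ∧ S q jq = t

/-- `S` is a schedule that Greedy (with some tie-breaking rule) produces: it is feasible,
and in every time step, every router at which at least one packet is waiting forwards a
waiting packet of maximum priority among the packets waiting there. -/
def IsGreedy (I : PInstance k) (S : Sched I) : Prop :=
  Feasible I S ∧
  ∀ t i, (∃ p j, Waiting I S p j t ∧ I.start p + j = i) →
    ∃ q jq, Waiting I S q jq t ∧ I.start q + jq = i ∧ S q jq = t ∧
      ∀ p j, Waiting I S p j t → I.start p + j = i → prio I S p t ≤ prio I S q t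

/-- The number of packets released by time `t` that still need to be forwarded by
router `i` at time `t` under schedule `S`. -/
noncomputable def needs (I : PInstance k) (S : Sched I) (i t : ℕ) : ℕ :=
  Set.ncard {p : Fin I.n | I.rel p ≤ t ∧ ∃ j, j < I.len p ∧ I.start p + j = i ∧ t ≤ S p j}

end PInstance

/-- The static part of the negated priority: at every router, Greedy prefers the waiting packet
for which `urg` is smallest. -/
def PInstance.urg {k : ℕ} (I : PInstance k) (p : Fin I.n) : ℤ :=
  (I.rel p : ℤ) - I.start p - I.len p

/-- Packet `p` has to be forwarded by router `i`. -/
def PInstance.Uses {k : ℕ} (I : PInstance k) (i : ℕ) (p : Fin I.n) : Prop :=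
  I.start p ≤ i ∧ i < I.start p + I.len p

open Classical in
/-- The packets with `urg` at most `K` that router `i` forwards at time `t` or later. -/
noncomputable def PInstance.pending {k : ℕ} (I : PInstance k) (S : PInstance.Sched I) (K : ℤ)
    (i t : ℕ) : Finset (Fin I.n) :=
  Finset.univ.filter fun p => I.urg p ≤ K ∧ I.Uses i p ∧ t ≤ S p (i - I.start p)

/-- Bound on the number of packets by which Greedy lags behind a schedule of cost `T`
at router `m + 1`. -/
def lagBound (T : ℕ) : ℕ → ℕ
  | 0 => 0
  | m + 1 => (lagBound T m + T) / 2

theorem lagBound_le (T m : ℕ) : lagBound T m ≤ T := by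
  induction m with
  | zero => simp [lagBound]
  | succ m ih => simp only [lagBound]; omega

theorem lagBound_mono (T : ℕ) : Monotone (lagBound T) :=
  monotone_nat_of_le_succ fun m => by
    have := lagBound_le T m
    simp only [lagBound]
    omega

theorem lagBound_cast_le (T m : ℕ) : (lagBound T m : ℝ) ≤ (1 - 1 / 2 ^ m) * T := by
  induction m with
  | zero => simp [lagBound]
  | succ m ih =>
    have h : (2 * lagBound T (m + 1) : ℝ) ≤ lagBound T m + T := by
      have : 2 * lagBound T (m + 1) ≤ lagBound T m + T := by simp only [lagBound]; omega
      exact_mod_cast this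
    have e : (1 - 1 / 2 ^ (m + 1)) * (T : ℝ) = ((1 - 1 / 2 ^ m) * T + T) / 2 := by
      rw [pow_succ]; field_simp; ring
    rw [e]
    linarith

namespace PInstance

variable {k : ℕ} {I : PInstance k} {S O : Sched I} {K : ℤ} {i t T : ℕ} {p q : Fin I.n}

theorem mem_pending :
    p ∈ I.pending S K i t ↔ I.urg p ≤ K ∧ I.Uses i p ∧ t ≤ S p (i - I.start p) := by
  simp [pending]

theorem Feasible.rel_le_hop (hF : I.Feasible S) (hS : I.Short) {j : ℕ} (hj : j < I.len p) :
    I.rel p ≤ S p j := by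
  have h0 := hF.1 p 0
  have h1 := hF.1 p 1
  have hl := hS p
  simp only [arr] at h0 h1
  obtain rfl | rfl : j = 0 ∨ j = 1 := by omega
  · exact h0 hj
  · have := h1 hj; have := h0 (by omega); omega

theorem Feasible.hop_zero_lt (hF : I.Feasible S) (h : I.len p = 2) : S p 0 < S p 1 := by
  have h1 := hF.1 p 1 (by omega)
  simp only [arr] at h1
  omega

theorem Feasible.eq_of_hop_eq (hF : I.Feasible S) (hp : I.Uses i p) (hq : I.Uses i q)
    (h : S p (i - I.start p) = S q (i - I.start q)) : p = q := by
  obtain ⟨h1, h2⟩ := hp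
  obtain ⟨h3, h4⟩ := hq
  exact hF.2 p q _ _ (by omega) (by omega) (by omega) h

theorem Feasible.card_le (hF : I.Feasible S) {A : Finset (Fin I.n)} {a b : ℕ}
    (hA : ∀ p ∈ A, I.Uses i p ∧ a ≤ S p (i - I.start p) ∧ S p (i - I.start p) < b) :
    A.card ≤ b - a := by
  rw [← Nat.card_Ico]
  refine Finset.card_le_card_of_injOn (fun p => S p (i - I.start p)) ?_ ?_
  · intro p hp
    simpa using (hA p hp).2
  · intro p hp q hq h
    exact hF.eq_of_hop_eq (hA p hp).1 (hA q hq).1 h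

theorem pending_succ_subset : I.pending S K i (t + 1) ⊆ I.pending S K i t := by
  intro p hp
  rw [mem_pending] at hp ⊢
  exact ⟨hp.1, hp.2.1, by omega⟩

theorem Feasible.card_pending_le_succ (hF : I.Feasible S) :
    (I.pending S K i t).card ≤ (I.pending S K i (t + 1)).card + 1 := by
  have h := Finset.card_sdiff_add_card_eq_card (pending_succ_subset (S := S) (K := K) (i := i)
    (t := t))
  have h1 : (I.pending S K i t \ I.pending S K i (t + 1)).card ≤ t + 1 - t := by
    refine hF.card_le (i := i) fun p hp => ?_
    simp only [Finset.mem_sdiff, mem_pending, not_and, not_le] at hp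
    exact ⟨hp.1.2.1, hp.1.2.2, hp.2 hp.1.1 hp.1.2.1⟩
  omega

theorem card_pending_succ_lt (hq : I.urg q ≤ K) (hu : I.Uses i q)
    (ht : S q (i - I.start q) = t) :
    (I.pending S K i (t + 1)).card < (I.pending S K i t).card := by
  refine Finset.card_lt_card (Finset.ssubset_iff_subset_ne.2 ⟨pending_succ_subset, fun h => ?_⟩)
  have h1 : q ∈ I.pending S K i t := mem_pending.2 ⟨hq, hu, ht.ge⟩
  rw [← h, mem_pending] at h1
  omega

theorem Feasible.remLen_eq (hF : I.Feasible S) (hS : I.Short) {j : ℕ}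
    (hw : I.Waiting S p j t) : I.remLen S p t = I.len p - j := by
  obtain ⟨hj, ha, ht⟩ := hw
  have : {j' : ℕ | j' < I.len p ∧ t ≤ S p j'} = (Finset.Ico j (I.len p) : Set ℕ) := by
    ext j'
    have hl := hS p
    simp only [Set.mem_ofPred_eq, Finset.coe_Ico, Set.mem_Ico]
    constructor
    · rintro ⟨h1, h2⟩
      refine ⟨?_, h1⟩
      by_contra hlt
      obtain ⟨rfl, rfl⟩ : j = 1 ∧ j' = 0 := by omega
      simp only [arr] at ha
      omega
    · rintro ⟨h1, h2⟩
      refine ⟨h2, ?_⟩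
      obtain rfl | ⟨rfl, rfl⟩ : j = j' ∨ j = 0 ∧ j' = 1 := by omega
      · exact ht
      · have := hF.hop_zero_lt (p := p) (by omega)
        omega
  rw [remLen, this, Set.ncard_coe_finset, Nat.card_Ico]

theorem Feasible.prio_eq (hF : I.Feasible S) (hS : I.Short) {j : ℕ}
    (hw : I.Waiting S p j t) (hi : I.start p + j = i) :
    (I.prio S p t : ℤ) = t - i - I.urg p := by
  have hr : I.rel p ≤ t := by
    obtain ⟨hj, ha, -⟩ := hw
    have hl := hS p
    obtain rfl | rfl : j = 0 ∨ j = 1 := by omega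
    · exact ha
    · have := hF.rel_le_hop hS (p := p) (j := 0) (by omega)
      simp only [arr] at ha
      omega
  have hj := hw.1
  rw [prio, hF.remLen_eq hS hw, urg]
  omega

/-- If a packet waits at a router, Greedy forwards a packet there that is at least as urgent. -/
theorem IsGreedy.exists_forwarded (hG : I.IsGreedy S) (hS : I.Short) (hu : I.Uses i p)
    (ha : I.arr S p (i - I.start p) ≤ t) (ht : t ≤ S p (i - I.start p)) :
    ∃ q, I.urg q ≤ I.urg p ∧ I.Uses i q ∧ S q (i - I.start q) = t := by
  obtain ⟨h1, h2⟩ := hu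
  have hw : I.Waiting S p (i - I.start p) t := ⟨by omega, ha, ht⟩
  obtain ⟨q, jq, hq, rfl, hqt, hmax⟩ := hG.2 t i ⟨p, _, hw, by omega⟩
  have hle := hmax p _ hw (by omega)
  have e1 := hG.1.prio_eq hS hw (i := I.start q + jq) (by omega)
  have e2 := hG.1.prio_eq hS hq rfl
  refine ⟨q, by omega, ⟨by omega, by have := hq.1; omega⟩, ?_⟩
  simpa using hqt

theorem IsGreedy.card_pending_succ_lt (hG : I.IsGreedy S) (hS : I.Short) (hp : I.urg p ≤ K)
    (hu : I.Uses i p) (ha : I.arr S p (i - I.start p) ≤ t) (ht : t ≤ S p (i - I.start p)) :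
    (I.pending S K i (t + 1)).card < (I.pending S K i t).card := by
  obtain ⟨q, h1, h2, h3⟩ := hG.exists_forwarded hS hu ha ht
  exact PInstance.card_pending_succ_lt (h1.trans hp) h2 h3

/-- Either the pending set of router `i` shrinks, or its pending packets have not arrived. -/
theorem IsGreedy.pending_cases (hG : I.IsGreedy S) (hS : I.Short) (K : ℤ) (i t : ℕ) :
    (I.pending S K i (t + 1)).card < (I.pending S K i t).card ∨
    ∀ p ∈ I.pending S K i t, (I.start p = i ∧ t < I.rel p) ∨
      (I.start p + 1 = i ∧ I.len p = 2 ∧ t ≤ S p 0) := by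
  refine or_iff_not_imp_left.2 fun hn p hp => ?_
  rw [mem_pending] at hp
  have ha : ¬ I.arr S p (i - I.start p) ≤ t := fun ha =>
    hn (hG.card_pending_succ_lt hS hp.1 hp.2.1 ha hp.2.2)
  have hl := hS p
  obtain ⟨h1, h2⟩ := hp.2.1
  obtain rfl | rfl : i = I.start p ∨ i = I.start p + 1 := by omega
  · simp only [Nat.sub_self, arr] at ha
    exact Or.inl ⟨rfl, by omega⟩
  · simp only [Nat.add_sub_cancel_left, arr] at ha
    exact Or.inr ⟨rfl, by omega, by omega⟩

/-- `O` is a feasible schedule in which every packet has flow time at most `T`. -/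
def FlowLE (I : PInstance k) (O : Sched I) (T : ℕ) : Prop :=
  I.Feasible O ∧ ∀ p, O p (I.len p - 1) + 1 ≤ I.rel p + T

theorem FlowLE.hop_le (hO : I.FlowLE O T) (hS : I.Short) (hu : I.Uses i p) :
    (O p (i - I.start p) : ℤ) ≤ I.urg p + i + T := by
  have hf := hO.2 p
  obtain ⟨h1, h2⟩ := hu
  rw [urg]
  rcases hS p with hl | hl
  · obtain rfl : i = I.start p := by omega
    simp only [hl, Nat.sub_self] at hf ⊢
    omega
  · have := hO.1.hop_zero_lt hl
    rw [hl] at hf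
    change O p 1 + 1 ≤ _ at hf
    obtain rfl | rfl : i = I.start p ∨ i = I.start p + 1 := by omega
    · simp only [Nat.sub_self]
      omega
    · simp only [Nat.add_sub_cancel_left]
      omega

theorem FlowLE.pending_eq_empty (hO : I.FlowLE O T) (hS : I.Short) (ht : K + i + T < t) :
    I.pending O K i t = ∅ := by
  refine Finset.eq_empty_of_forall_notMem fun p hp => ?_
  rw [mem_pending] at hp
  have := hO.hop_le hS hp.2.1
  omega

open Classical in
/-- The packets that `O` has forwarded over router `i + 1` although Greedy has not even forwarded
them over their start router `i`. -/
noncomputable def overtaken (I : PInstance k) (S O : Sched I) (K : ℤ) (i t : ℕ) :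
    Finset (Fin I.n) :=
  Finset.univ.filter fun p =>
    I.urg p ≤ K ∧ I.start p = i ∧ I.len p = 2 ∧ t ≤ S p 0 ∧ O p 1 ≤ t

theorem IsGreedy.two_mul_card_overtaken_le (hG : I.IsGreedy S) (hS : I.Short)
    (hO : I.FlowLE O T) {b : ℕ} (hb : b ≤ T)
    (h : (I.pending S K i t).card ≤ (I.pending O K i t).card + b) :
    2 * (I.overtaken S O K i t).card ≤ b + T := by
  set Y := I.overtaken S O K i t with hY
  set W := I.pending O K i t \ I.pending S K i t with hW
  have hYS : Y ⊆ I.pending S K i t \ I.pending O K i t := by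
    intro p hp
    simp only [hY, overtaken, Finset.mem_filter, Finset.mem_univ, true_and] at hp
    obtain ⟨h1, rfl, h3, h4, h5⟩ := hp
    have := hO.1.hop_zero_lt h3
    simp only [Finset.mem_sdiff, mem_pending, Nat.sub_self, Uses]
    refine ⟨⟨h1, by omega, h4⟩, fun h => by omega⟩
  have hYW : Y.card ≤ W.card + b := by
    have e1 := Finset.card_sdiff_add_card_inter (I.pending S K i t) (I.pending O K i t)
    have e2 := Finset.card_sdiff_add_card_inter (I.pending O K i t) (I.pending S K i t)
    have e3 := Finset.card_le_card hYS
    rw [Finset.inter_comm, ← hW] at e2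
    omega
  rcases W.eq_empty_or_nonempty with hW0 | hWne
  · rw [hW0, Finset.card_empty] at hYW
    omega
  obtain ⟨u, huW, hu⟩ := W.exists_max_image (fun p => O p (i - I.start p)) hWne
  have hWspec : ∀ p ∈ W, I.urg p ≤ K ∧ I.Uses i p ∧ t ≤ O p (i - I.start p) ∧
      S p (i - I.start p) < t := by
    intro p hp
    simp only [hW, Finset.mem_sdiff, mem_pending, not_and, not_le] at hp
    exact ⟨hp.1.1, hp.1.2.1, hp.1.2.2, hp.2 hp.1.1 hp.1.2.1⟩
  obtain ⟨-, huU, huO, huS⟩ := hWspec u huW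
  have hWcard : W.card ≤ O u (i - I.start u) + 1 - t := hO.1.card_le (i := i) fun p hp => by
    obtain ⟨-, h2, h3, -⟩ := hWspec p hp
    have := hu p hp
    exact ⟨h2, h3, by omega⟩
  have huhop := hO.hop_le hS huU
  have hurel : I.rel u ≤ S u (i - I.start u) :=
    hG.1.rel_le_hop hS (by obtain ⟨h1, h2⟩ := huU; omega)
  have hYcard : Y.card ≤ t - I.rel u := hO.1.card_le (i := i) fun z hz => by
    simp only [hY, overtaken, Finset.mem_filter, Finset.mem_univ, true_and] at hz
    obtain ⟨h1, h2, h3, h4, h5⟩ := hz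
    subst h2
    have h01 := hO.1.hop_zero_lt h3
    have hzrel := hO.1.rel_le_hop hS (p := z) (j := 0) (by omega)
    rw [Nat.sub_self]
    refine ⟨⟨le_rfl, by omega⟩, ?_, by omega⟩
    by_contra hlt
    obtain ⟨q, hq1, hq2, hq3⟩ := hG.exists_forwarded hS (p := z) (i := I.start z)
      (t := S u (I.start z - I.start u)) ⟨le_rfl, by omega⟩
      (by simp only [Nat.sub_self, arr]; omega) (by rw [Nat.sub_self]; omega)
    obtain rfl := hG.1.eq_of_hop_eq hq2 huU hq3
    obtain ⟨h6, h7⟩ := huU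
    have := hS q
    rw [urg, urg] at hq1
    omega
  obtain ⟨h6, h7⟩ := huU
  rw [urg] at huhop
  omega

/-- Whenever Greedy does not make progress at router `i`, its lag consists of overtaken packets. -/
theorem IsGreedy.card_pending_le (hG : I.IsGreedy S) (hS : I.Short) (hO : I.Feasible O)
    {b : ℕ} (hb : ∀ t, ∀ A : Finset (Fin I.n), (∀ p ∈ A, I.urg p ≤ K ∧ I.start p + 1 = i ∧
      I.len p = 2 ∧ t ≤ S p 0 ∧ O p 1 ≤ t) → A.card ≤ b) (t : ℕ) :
    (I.pending S K i t).card ≤ (I.pending O K i t).card + b := by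
  induction t with
  | zero =>
    have : I.pending S K i 0 = I.pending O K i 0 := by ext; simp [mem_pending]
    rw [this]
    omega
  | succ t ih =>
    rcases hG.pending_cases hS K i t with h | h
    · have := hO.card_pending_le_succ (K := K) (i := i) (t := t)
      omega
    · have h1 : (I.pending S K i (t + 1) \ I.pending O K i (t + 1)).card ≤ b := by
        refine hb t _ fun p hp => ?_
        rw [Finset.mem_sdiff] at hp
        obtain ⟨hp1, hp2⟩ := hp
        have hp3 := mem_pending.1 hp1
        have hp4 : O p (i - I.start p) ≤ t := by
          by_contra hlt
          exact hp2 (mem_pending.2 ⟨hp3.1, hp3.2.1, by omega⟩)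
        rcases h p (pending_succ_subset hp1) with ⟨rfl, h3⟩ | ⟨rfl, h3, h4⟩
        · have := hO.rel_le_hop hS (p := p) (j := 0) (by have := hS p; omega)
          rw [Nat.sub_self] at hp4
          omega
        · rw [Nat.add_sub_cancel_left] at hp4
          exact ⟨hp3.1, rfl, h3, h4, hp4⟩
      have := Finset.le_card_sdiff (I.pending O K i (t + 1)) (I.pending S K i (t + 1))
      omega

theorem IsGreedy.card_pending_le_lagBound (hG : I.IsGreedy S) (hV : I.Valid) (hS : I.Short)
    (hO : I.FlowLE O T) (K : ℤ) (m t : ℕ) :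
    (I.pending S K (m + 1) t).card ≤ (I.pending O K (m + 1) t).card + lagBound T m := by
  induction m generalizing t with
  | zero =>
    refine hG.card_pending_le hS hO.1 (fun t A hA => ?_) t
    rw [Finset.eq_empty_of_forall_notMem (s := A) fun p hp => ?_]
    · simp
    · have := (hA p hp).2.1
      have := (hV p).1
      omega
  | succ m ih =>
    refine hG.card_pending_le hS hO.1 (fun t A hA => ?_) t
    have h1 := hG.two_mul_card_overtaken_le hS hO (lagBound_le T m) (ih t)
    have h2 : A.card ≤ (I.overtaken S O K (m + 1) t).card := by
      refine Finset.card_le_card fun p hp => ?_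
      have := hA p hp
      simp only [overtaken, Finset.mem_filter, Finset.mem_univ, true_and]
      exact ⟨this.1, by omega, this.2.2⟩
    simp only [lagBound]
    omega

/-- A packet on its first hop is forwarded before the packets that are at most as urgent. -/
theorem IsGreedy.hop_zero_lt (hG : I.IsGreedy S) (hS : I.Short) {n : ℕ} (ht : I.rel p ≤ t)
    (hn : (I.pending S (I.urg p) (I.start p) t).card ≤ n) : S p 0 < t + n := by
  have hu : I.Uses (I.start p) p := ⟨le_rfl, by have := hS p; omega⟩
  induction n generalizing t with
  | zero =>
    by_contra hlt
    have : p ∈ I.pending S (I.urg p) (I.start p) t :=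
      mem_pending.2 ⟨le_rfl, hu, by rw [Nat.sub_self]; omega⟩
    have := Finset.card_pos.2 ⟨p, this⟩
    omega
  | succ n ih =>
    by_cases hlt : S p 0 < t
    · omega
    have := hG.card_pending_succ_lt hS (t := t) le_rfl hu
      (by rw [Nat.sub_self]; exact ht) (by rw [Nat.sub_self]; omega)
    have := ih (t := t + 1) (by omega) (by omega)
    omega

theorem IsGreedy.hop_one_lt (hG : I.IsGreedy S) (hS : I.Short) {n : ℕ} (hl : I.len p = 2)
    (ht : I.rel p + 1 ≤ t)
    (hn : (I.pending S (I.urg p) (I.start p + 1) t).card ≤ n)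
    (hn' : S p 0 < t ∨ (I.pending S (I.urg p) (I.start p) t).card + 1 ≤ n) :
    S p 1 < t + n := by
  have hu : I.Uses (I.start p) p := ⟨le_rfl, by omega⟩
  have hu' : I.Uses (I.start p + 1) p := ⟨by omega, by omega⟩
  induction n generalizing t with
  | zero =>
    by_contra hlt
    have : p ∈ I.pending S (I.urg p) (I.start p + 1) t :=
      mem_pending.2 ⟨le_rfl, hu', by rw [Nat.add_sub_cancel_left]; omega⟩
    have := Finset.card_pos.2 ⟨p, this⟩
    omega
  | succ n ih =>
    by_cases hlt : S p 1 < t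
    · omega
    have key : S p 1 < t + 1 + n := by
      by_cases h0 : S p 0 < t
      · have := hG.card_pending_succ_lt hS (t := t) le_rfl hu'
          (by rw [Nat.add_sub_cancel_left]; exact h0)
          (by rw [Nat.add_sub_cancel_left]; omega)
        exact ih (by omega) (by omega) (Or.inl (by omega))
      · have h1 := hG.card_pending_succ_lt hS (t := t) le_rfl hu
          (by rw [Nat.sub_self]; simp only [arr]; omega) (by rw [Nat.sub_self]; omega)
        refine ih (by omega) ?_ (Or.inr (by omega))
        rcases hG.pending_cases hS (I.urg p) (I.start p + 1) t with h | h
        · omega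
        · have h2 : I.pending S (I.urg p) (I.start p + 1) (t + 1) ⊆
              I.pending S (I.urg p) (I.start p) t := by
            intro q hq
            have hq' := mem_pending.1 (pending_succ_subset hq)
            rcases h q (pending_succ_subset hq) with ⟨h3, h4⟩ | ⟨h3, h4, h5⟩
            · have := hq'.1
              have := hS q
              rw [urg, urg] at *
              omega
            · have h6 : I.start q = I.start p := by omega
              refine mem_pending.2 ⟨hq'.1, ⟨by omega, by omega⟩, ?_⟩
              rw [h6, Nat.sub_self]
              exact h5
          have := Finset.card_le_card h2
          omega
    omega

theorem IsGreedy.comp_le (hG : I.IsGreedy S) (hV : I.Valid) (hS : I.Short)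
    (hO : I.FlowLE O T) (p : Fin I.n) :
    I.comp S p ≤ I.rel p + T + lagBound T (k - 1) := by
  obtain ⟨hv1, hv2, hv3⟩ := hV p
  have hT : I.len p ≤ T := by
    have h1 := hO.2 p
    have h2 := hO.1.rel_le_hop hS (p := p) (j := 0) (by omega)
    rcases hS p with hl | hl
    · rw [hl] at h1 ⊢
      simp only [Nat.sub_self] at h1
      omega
    · have := hO.1.hop_zero_lt hl
      rw [hl] at h1 ⊢
      simp only [Nat.add_one_sub_one] at h1
      omega
  obtain ⟨m, hm⟩ : ∃ m, I.start p = m + 1 := ⟨I.start p - 1, by omega⟩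
  have lag : ∀ m t : ℕ, I.urg p + (m + 1 : ℕ) + T < t →
      (I.pending S (I.urg p) (m + 1) t).card ≤ lagBound T m := fun m t h => by
    have := hG.card_pending_le_lagBound hV hS hO (I.urg p) m t
    rwa [hO.pending_eq_empty hS h, Finset.card_empty, zero_add] at this
  rcases hS p with hl | hl
  · have h1 : (I.pending S (I.urg p) (I.start p) (I.rel p + T)).card ≤ lagBound T m := by
      rw [hm]
      exact lag _ _ (by rw [urg]; omega)
    have h2 := hG.hop_zero_lt hS (by omega) h1
    have h3 : lagBound T m ≤ lagBound T (k - 1) := lagBound_mono T (by omega)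
    rw [comp, hl, Nat.sub_self]
    omega
  · have h1 : (I.pending S (I.urg p) (I.start p + 1) (I.rel p + T)).card ≤
        lagBound T (m + 1) := by
      rw [hm]
      exact lag _ _ (by rw [urg]; omega)
    have h0 : (I.pending S (I.urg p) (I.start p) (I.rel p + T - 1)).card ≤ lagBound T m := by
      rw [hm]
      exact lag _ _ (by rw [urg]; omega)
    have h2 : lagBound T m ≤ lagBound T (m + 1) := lagBound_mono T (by omega)
    have h3 : lagBound T (m + 1) ≤ lagBound T (k - 1) := lagBound_mono T (by omega)
    have h4 := hG.hop_one_lt hS hl (by omega) h1 (by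
      refine or_iff_not_imp_left.2 fun hlt => ?_
      have := hG.card_pending_succ_lt hS (p := p) (i := I.start p) (t := I.rel p + T - 1) le_rfl
        ⟨le_rfl, by omega⟩ (by rw [Nat.sub_self]; simp only [arr]; omega)
        (by rw [Nat.sub_self]; omega)
      rw [show I.rel p + T - 1 + 1 = I.rel p + T by omega] at this
      omega)
    rw [comp, hl]
    simp only [Nat.add_one_sub_one]
    omega

theorem exists_flowLE_opt (hF : I.Feasible S) : ∃ O, I.FlowLE O I.opt := by
  obtain ⟨O, hO, hc⟩ := Nat.sInf_mem (s := {c | ∃ S : Sched I, Feasible I S ∧ cost I S = c})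
    ⟨_, S, hF, rfl⟩
  refine ⟨O, hO, fun p => ?_⟩
  have h : I.flowTime O p ≤ I.cost O := Finset.le_sup (f := I.flowTime O) (Finset.mem_univ p)
  rw [hc, ← opt, flowTime, comp] at h
  omega

theorem IsGreedy.cost_le (hG : I.IsGreedy S) (hV : I.Valid) (hS : I.Short) :
    I.cost S ≤ I.opt + lagBound I.opt (k - 1) := by
  obtain ⟨O, hO⟩ := exists_flowLE_opt hG.1
  refine Finset.sup_le fun p _ => ?_
  have := hG.comp_le hV hS hO p
  rw [flowTime]
  omega

end PInstance

/-- If there are `k` routers and all packets of the instance `I` have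
length `1` or `2`, then, for any tie-breaking rule (i.e. for every schedule `S` that
Greedy can produce on `I`), `Greedy(I) ≤ (2 − 1/2^{k−1})·Opt(I) + 3`; in particular,
Greedy is `(2 − 1/2^{k−1})`-competitive on such instances. -/
theorem greedy_upper_bound {k : ℕ} (I : PInstance k) (hV : I.Valid) (hS : I.Short)
    (S : PInstance.Sched I) (hG : I.IsGreedy S) :
    (I.cost S : ℝ) ≤ (2 - 1 / 2 ^ (k - 1)) * (I.opt : ℝ) + 3 := by
  have h : (I.cost S : ℝ) ≤ I.opt + lagBound I.opt (k - 1) := by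
    exact_mod_cast hG.cost_le hV hS
  have hb := lagBound_cast_le I.opt (k - 1)
  have e : (2 - 1 / 2 ^ (k - 1)) * (I.opt : ℝ) = I.opt + (1 - 1 / 2 ^ (k - 1)) * I.opt := by ring
  rw [e]
  linarith
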